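/- In the setting of the localisation lemma (odd L ≥ 3, k ≤ N̄ ≤ N, π : T_N → T_{N̄} the projection, τ : 𝒱_{N̄} → 𝒱_N the pull-back (τφ)(x) = φ(πx), and τ* : 𝒱_N → 𝒱_{N̄} its adjoint, given by (τ*v)(x̄) = Σ_{x: π(x)=x̄} v(x)): let 𝒞_{k,N̄} be the translation invariant positive semi-definite operator on 𝒱_N whose kernel is the (L^{N̄}ℤ)^d-periodized kernel C_{k,N̄}, let 𝒟_{k,N̄} be the operator on 𝒱_{N̄} with kernel D_{k,N̄}(π(x)) = C_{k,N̄}(x), and let μ_{k,N̄} and ν_{k,N̄} be the centered Gaussian measures on 𝒱_N and 𝒱_{N̄} with covariances 𝒞_{k,N̄} and 𝒟_{k,N̄} respectively. Then (i) ⟨τ*v, 𝒟_{k,N̄} τ*v⟩ = ⟨v, 𝒞_{k,N̄} v⟩ for all v ∈ 𝒱_N, and (ii) μ_{k,N̄} = τ_* ν_{k,N̄}, i.e. μ_{k,N̄} is the push-forward of ν_{k,N̄} along τ. -/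

import Mathlib

open Matrix Complex MeasureTheory
open scoped Matrix BigOperators ComplexOrder

noncomputable section

/-- The discrete torus `T_N = (ℤ/L^Nℤ)^d`. -/
abbrev Torus (L N d : ℕ) := Fin d → ZMod (L ^ N)

/-- Quotient maximum distance `d_∞` on the discrete torus. -/
def torusDist {L N d : ℕ} (x y : Torus L N d) : ℕ :=
  Finset.univ.sup fun i => min (x i - y i).val (L ^ N - (x i - y i).val)

/-- The point of the dual torus `T̂_N ⊂ (-π,π)^d` associated to `k : T_N`. -/
def dualPt (L N d : ℕ) (k : Torus L N d) : Fin d → ℝ := fun i =>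
  2 * Real.pi *
    (if 2 * (k i).val + 1 ≤ L ^ N then ((k i).val : ℝ) else ((k i).val : ℝ) - L ^ N) /
    (L ^ N : ℝ)

/-- Euclidean norm of a frequency vector. -/
def pnorm {d : ℕ} (p : Fin d → ℝ) : ℝ := Real.sqrt (∑ i, p i ^ 2)

/-- `p` lies in the dyadic annulus `A_j` of the dual torus. -/
def inAnn (L : ℕ) {d : ℕ} (j : ℕ) (p : Fin d → ℝ) : Prop :=
  if j = 0 then ((L : ℝ))⁻¹ < pnorm p
  else ((L : ℝ) ^ (j + 1))⁻¹ < pnorm p ∧ pnorm p ≤ ((L : ℝ) ^ j)⁻¹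

/-- Fourier transform of a matrix-valued kernel at frequency `p`:
`Ĉ(p) = Σ_x e^{−ip·x} C(x)`. -/
def fourierAt {L N d m : ℕ} [NeZero (L ^ N)]
    (C : Torus L N d → Matrix (Fin m) (Fin m) ℝ) (p : Fin d → ℝ) :
    Matrix (Fin m) (Fin m) ℂ :=
  ∑ x : Torus L N d,
    Complex.exp (-Complex.I * ∑ i, (p i : ℂ) * ((x i).val : ℂ)) • (C x).map Complex.ofReal

/-- Forward shift by a multiindex. -/
def shiftF {L N d : ℕ} (β : Fin d → ℕ) (x : Torus L N d) : Torus L N d :=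
  fun i => x i + (β i : ZMod (L ^ N))

/-- Backward shift by a multiindex. -/
def shiftB {L N d : ℕ} (β : Fin d → ℕ) (x : Torus L N d) : Torus L N d :=
  fun i => x i - (β i : ZMod (L ^ N))

/-- The mixed discrete forward derivative `∇^α` (binomial formula). -/
def nablaF {L N d : ℕ} {E : Type*} [AddCommGroup E] [Module ℝ E]
    (α : Fin d → ℕ) (f : Torus L N d → E) (x : Torus L N d) : E :=
  ∑ β ∈ Fintype.piFinset fun i => Finset.range (α i + 1),
    ((-1 : ℝ) ^ (∑ i, (α i - β i)) * ∏ i, ((α i).choose (β i) : ℝ)) • f (shiftF β x)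

/-- The mixed discrete backward derivative `(∇^α)^*` (binomial formula). -/
def nablaB {L N d : ℕ} {E : Type*} [AddCommGroup E] [Module ℝ E]
    (α : Fin d → ℕ) (f : Torus L N d → E) (x : Torus L N d) : E :=
  ∑ β ∈ Fintype.piFinset fun i => Finset.range (α i + 1),
    ((-1 : ℝ) ^ (∑ i, (α i - β i)) * ∏ i, ((α i).choose (β i) : ℝ)) • f (shiftB β x)

/-- Index set for the block matrix `A : G → G`, `G = (ℝ^m)^𝓜`. -/
abbrev Idx (d m : ℕ) (𝓜 : Finset (Fin d → ℕ)) := {α // α ∈ 𝓜} × Fin m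

/-- `ℓ²`-operator norm of `A : G → G`. -/
def opA {d m : ℕ} {𝓜 : Finset (Fin d → ℕ)} (A : Idx d m 𝓜 → Idx d m 𝓜 → ℝ) : ℝ :=
  ‖Matrix.toEuclideanCLM (𝕜 := ℝ) (Matrix.of A)‖

/-- `ℓ²`-operator norm of a complex `m×m` matrix. -/
def opC {m : ℕ} (M : Matrix (Fin m) (Fin m) ℂ) : ℝ :=
  ‖Matrix.toEuclideanCLM (𝕜 := ℂ) M‖

/-- `ℓ²`-operator norm of a real `m×m` matrix. -/
def opR {m : ℕ} (M : Matrix (Fin m) (Fin m) ℝ) : ℝ :=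
  ‖Matrix.toEuclideanCLM (𝕜 := ℝ) M‖

/-- The elliptic finite difference operator `𝒜 = Σ_{α,β∈𝓜} (∇^α)^* A_{αβ} ∇^β`. -/
def Aop {L N d m : ℕ} {𝓜 : Finset (Fin d → ℕ)}
    (A : Idx d m 𝓜 → Idx d m 𝓜 → ℝ) (φ : Torus L N d → Fin m → ℝ) :
    Torus L N d → Fin m → ℝ :=
  fun x r => ∑ α : {a // a ∈ 𝓜}, ∑ β : {a // a ∈ 𝓜}, ∑ s : Fin m,
    A (α, r) (β, s) * nablaB α.1 (nablaF β.1 fun z => φ z s) x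

/-- The set `𝓛(G, ω₀, Ω₀)`: symmetric `A` with `‖A‖ ≤ Ω₀` and `(z, Az) ≥ ω₀|z^∇|²`
(the gradient components being the multiindices of order 1). -/
def memL (d m : ℕ) (𝓜 : Finset (Fin d → ℕ)) (ω₀ Ω₀ : ℝ)
    (A : Idx d m 𝓜 → Idx d m 𝓜 → ℝ) : Prop :=
  (∀ a b, A a b = A b a) ∧ opA A ≤ Ω₀ ∧
    ∀ z : Idx d m 𝓜 → ℝ,
      ω₀ * ∑ a : Idx d m 𝓜, (if (∑ i, (a.1 : Fin d → ℕ) i) = 1 then z a ^ 2 else 0) ≤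
        ∑ a, ∑ b, z a * A a b * z b

/-- Action of a translation invariant operator given by its kernel: `(𝒞φ)(x) = Σ_y C(x−y)φ(y)`. -/
def kerApp {L N d m : ℕ} [NeZero (L ^ N)]
    (C : Torus L N d → Matrix (Fin m) (Fin m) ℝ) (φ : Torus L N d → Fin m → ℝ) :
    Torus L N d → Fin m → ℝ :=
  fun x => ∑ y, C (x - y) *ᵥ φ y

/-- Quadratic form `⟨φ, 𝒞φ⟩` of a translation invariant operator with kernel `C`. -/
def quadForm {L N d m : ℕ} [NeZero (L ^ N)]
    (C : Torus L N d → Matrix (Fin m) (Fin m) ℝ) (φ : Torus L N d → Fin m → ℝ) : ℝ :=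
  ∑ x, φ x ⬝ᵥ kerApp C φ x

end

/-- The scalar product `⟨v, φ⟩ = Σ_x v(x)·φ(x)` of two fields. -/
def innerF {L N d m : ℕ} [NeZero (L ^ N)]
    (v φ : Torus L N d → Fin m → ℝ) : ℝ :=
  ∑ x, v x ⬝ᵥ φ x

/-- A sum over the target against fibrewise sums is a sum over the source. -/
theorem sum_dotProduct_sum_fiber {α β ι : Type*} [Fintype α] [Fintype β] [DecidableEq β]
    [Fintype ι] (p : α → β) (v : α → ι → ℝ) (g : β → ι → ℝ) :
    ∑ b, (∑ a ∈ Finset.univ.filter (fun a => p a = b), v a) ⬝ᵥ g b =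
      ∑ a, v a ⬝ᵥ g (p a) := by
  rw [← Finset.sum_fiberwise Finset.univ p]
  refine Finset.sum_congr rfl fun b _ => ?_
  rw [sum_dotProduct]
  refine Finset.sum_congr rfl fun a ha => ?_
  rw [(Finset.mem_filter.mp ha).2]

/-- A sum of matrix actions on fibrewise sums is a sum over the source. -/
theorem sum_mulVec_sum_fiber {α β ι : Type*} [Fintype α] [Fintype β] [DecidableEq β]
    [Fintype ι] (p : α → β) (v : α → ι → ℝ) (A : β → Matrix ι ι ℝ) :
    ∑ b, A b *ᵥ (∑ a ∈ Finset.univ.filter (fun a => p a = b), v a) =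
      ∑ a, A (p a) *ᵥ v a := by
  rw [← Finset.sum_fiberwise Finset.univ p]
  refine Finset.sum_congr rfl fun b _ => ?_
  rw [mulVec_sum]
  refine Finset.sum_congr rfl fun a ha => ?_
  rw [(Finset.mem_filter.mp ha).2]

/-- Fibrewise summation along a subtractive map intertwines the quadratic forms of a kernel and
of its pull-back. -/
theorem quadForm_sum_fiber {L N Nb d m : ℕ} [NeZero (L ^ N)] [NeZero (L ^ Nb)]
    (p : Torus L N d → Torus L Nb d) (hp : ∀ x y, p (x - y) = p x - p y)
    (C : Torus L N d → Matrix (Fin m) (Fin m) ℝ) (D : Torus L Nb d → Matrix (Fin m) (Fin m) ℝ)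
    (hD : ∀ x, D (p x) = C x) (v : Torus L N d → Fin m → ℝ) :
    quadForm D (fun b => ∑ x ∈ Finset.univ.filter (fun x => p x = b), v x) = quadForm C v := by
  unfold quadForm
  rw [sum_dotProduct_sum_fiber]
  refine Finset.sum_congr rfl fun x _ => ?_
  unfold kerApp
  rw [sum_mulVec_sum_fiber p v fun b => D (p x - b)]
  simp only [← hp, hD]

/-- Every continuous linear functional on fields is the scalar product with some field. -/
theorem exists_innerF_eq {L N d m : ℕ} [NeZero (L ^ N)]
    (ℓ : StrongDual ℝ (Torus L N d → Fin m → ℝ)) :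
    ∃ v : Torus L N d → Fin m → ℝ, ∀ φ, ℓ φ = innerF v φ := by
  refine ⟨fun x i => ℓ (Pi.single x (Pi.single i 1)), fun φ => ?_⟩
  have hφ : φ = ∑ x, ∑ i, φ x i • (Pi.single x (Pi.single i 1) : Torus L N d → Fin m → ℝ) := by
    ext y j
    simp [Finset.sum_apply, Pi.single_apply, apply_ite (fun f : Fin m → ℝ => f j)]
  conv_lhs => rw [hφ]
  simp [innerF, dotProduct, mul_comm]

/-- A finite measure on fields is determined by its characteristic function. -/
theorem measure_ext_of_innerF {L N d m : ℕ} [NeZero (L ^ N)]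
    (μ ν : Measure (Torus L N d → Fin m → ℝ)) [IsFiniteMeasure μ] [IsFiniteMeasure ν]
    (h : ∀ v : Torus L N d → Fin m → ℝ,
      ∫ φ, Complex.exp (Complex.I * (innerF v φ : ℝ)) ∂μ =
        ∫ φ, Complex.exp (Complex.I * (innerF v φ : ℝ)) ∂ν) : μ = ν := by
  refine Measure.ext_of_charFunDual (funext fun ℓ => ?_)
  obtain ⟨v, hv⟩ := exists_innerF_eq ℓ
  simpa only [charFunDual_apply, hv, mul_comm] using h v

/-- Fibrewise summation is the adjoint of the pull-back. -/
theorem innerF_comp {L N Nb d m : ℕ} [NeZero (L ^ N)] [NeZero (L ^ Nb)]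
    (p : Torus L N d → Torus L Nb d) (v : Torus L N d → Fin m → ℝ)
    (ψ : Torus L Nb d → Fin m → ℝ) :
    innerF v (fun x => ψ (p x)) =
      innerF (fun b => ∑ x ∈ Finset.univ.filter (fun x => p x = b), v x) ψ :=
  (sum_dotProduct_sum_fiber p v ψ).symm

/-- Measurability of the pull-back of fields. -/
theorem measurable_pullback {L N Nb d m : ℕ} (p : Torus L N d → Torus L Nb d) :
    Measurable fun (ψ : Torus L Nb d → Fin m → ℝ) (x : Torus L N d) => ψ (p x) :=
  measurable_pi_lambda _ fun x => measurable_pi_apply (p x)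

/-- Continuity of the scalar product in its second argument. -/
theorem continuous_innerF {L N d m : ℕ} [NeZero (L ^ N)] (v : Torus L N d → Fin m → ℝ) :
    Continuous (innerF v) := by
  unfold innerF dotProduct
  fun_prop

/-- **Push-forward step of the localisation lemma** (Step 2 of Lemma 4.2). If `𝒞_{k,N̄}`
is the operator on `𝒱_N` with the `(L^{N̄}ℤ)^d`-periodised kernel, `𝒟_{k,N̄}` the induced
operator on `𝒱_{N̄}`, and `μ_{k,N̄}`, `ν_{k,N̄}` the associated centered Gaussian measures,
then `⟨τ*v, 𝒟_{k,N̄}τ*v⟩ = ⟨v, 𝒞_{k,N̄}v⟩` for all `v` and `μ_{k,N̄} = τ_*ν_{k,N̄}`. -/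
theorem stmt16 (L d m k Nb N : ℕ) (hL : Odd L) (hL3 : 3 ≤ L) (hd : 2 ≤ d) (hm : 1 ≤ m)
    (hk : k ≤ Nb) (hNb : Nb ≤ N) [NeZero (L ^ N)] [NeZero (L ^ Nb)]
    (C : Torus L N d → Matrix (Fin m) (Fin m) ℝ)
    (M : Matrix (Fin m) (Fin m) ℝ) (hM : M.PosSemidef)
    (hC : ∀ x : Torus L N d, ((L : ℝ) ^ k) / 2 ≤ (torusDist x 0 : ℝ) → C x = -M)
    (CkN : Torus L N d → Matrix (Fin m) (Fin m) ℝ)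
    -- `C_{k,N̄}` is the periodised kernel `L^{−N̄d} Σ_{p∈T̂_{N̄}} e^{ipx}Ĉ_k(p) + (L^{(N−N̄)d}−1)M`
    (hCkN : ∀ x : Torus L N d, (CkN x).map Complex.ofReal =
      ((L : ℂ) ^ (Nb * d))⁻¹ • (∑ q : Torus L Nb d,
        Complex.exp (Complex.I * ∑ i, (dualPt L Nb d q i : ℂ) * ((x i).val : ℂ)) •
          fourierAt C (dualPt L Nb d q)) +
      ((L : ℂ) ^ ((N - Nb) * d) - 1) • M.map Complex.ofReal)
    (hCkNpos : ∀ φ : Torus L N d → Fin m → ℝ, 0 ≤ quadForm CkN φ)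
    (DkN : Torus L Nb d → Matrix (Fin m) (Fin m) ℝ)
    -- the periodised kernel defines a kernel `D_{k,N̄}` on the coarse torus
    (hDkN : ∀ x : Torus L N d,
      DkN (fun i => ZMod.castHom (pow_dvd_pow L hNb) (ZMod (L ^ Nb)) (x i)) = CkN x)
    (μ : Measure ((Torus L N d) → Fin m → ℝ)) (hμp : IsProbabilityMeasure μ)
    (hμ : ∀ v : Torus L N d → Fin m → ℝ,
      ∫ φ, Complex.exp (Complex.I * (innerF v φ : ℝ)) ∂μ =
        Complex.exp (-(1 / 2 : ℂ) * (quadForm CkN v : ℝ)))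
    (ν : Measure ((Torus L Nb d) → Fin m → ℝ)) (hνp : IsProbabilityMeasure ν)
    (hν : ∀ v : Torus L Nb d → Fin m → ℝ,
      ∫ ψ, Complex.exp (Complex.I * (innerF v ψ : ℝ)) ∂ν =
        Complex.exp (-(1 / 2 : ℂ) * (quadForm DkN v : ℝ))) :
    -- (i) the adjoint `τ*` intertwines the two quadratic forms
    (∀ v : Torus L N d → Fin m → ℝ,
      quadForm DkN (fun xb => ∑ x ∈ Finset.univ.filter
          (fun x : Torus L N d =>
            (fun i => ZMod.castHom (pow_dvd_pow L hNb) (ZMod (L ^ Nb)) (x i)) = xb), v x) =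
        quadForm CkN v) ∧
    -- (ii) `μ_{k,N̄}` is the push-forward of `ν_{k,N̄}` along the pull-back `τ`
    μ = ν.map (fun ψ => fun x : Torus L N d =>
      ψ fun i => ZMod.castHom (pow_dvd_pow L hNb) (ZMod (L ^ Nb)) (x i)) := by
  have hquad := quadForm_sum_fiber
    (fun (x : Torus L N d) i => ZMod.castHom (pow_dvd_pow L hNb) (ZMod (L ^ Nb)) (x i))
    (fun x y => funext fun i => map_sub _ (x i) (y i)) CkN DkN hDkN
  have hτ := measurable_pullback (m := m)
    (fun (x : Torus L N d) i => ZMod.castHom (pow_dvd_pow L hNb) (ZMod (L ^ Nb)) (x i))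
  refine ⟨hquad, ?_⟩
  have := Measure.isProbabilityMeasure_map (μ := ν) hτ.aemeasurable
  refine measure_ext_of_innerF _ _ fun v => ?_
  have hcont := continuous_innerF v
  rw [hμ, integral_map hτ.aemeasurable (by fun_prop), ← hquad, ← hν]
  exact integral_congr_ae (.of_forall fun ψ => by simp only [innerF_comp])
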